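/- arXiv:1511.03687 — 2 statements merged into one kernel-verified Lean document; each statement's English description precedes it below -/
import Mathlib

section
/- Let f, φ be as in the context and X̃ ∈ ℂ^{n×n}. Suppose that at every active eigenvalue λ of X̃, f is differentiable in the real sense on a neighborhood of λ, ∇f is continuous at λ, and ∇f(λ) ≠ 0. If some active eigenvalue of X̃ has geometric multiplicity at least 2, then the limiting subdifferential ∂φ(X̃) strictly contains the regular subdifferential ∂̂φ(X̃). -/
open Filter Topology Asymptotics Matrix

noncomputable section

abbrev Mat (n : ℕ) := Matrix (Fin n) (Fin n) ℂ

/-- `lam` is an eigenvalue of `X`: a root of `det (lam • I - X) = 0`. -/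
def IsEigenvalue {n : ℕ} (X : Mat n) (lam : ℂ) : Prop :=
  (lam • (1 : Mat n) - X).det = 0

/-- The spectral max function generated by `f`. -/
def specMax {n : ℕ} (f : ℂ → EReal) (X : Mat n) : EReal :=
  sSup (f '' {lam | IsEigenvalue X lam})

/-- Real inner product on `ℂ^{n×n}`: `⟨Y,Z⟩ = Re tr (Yᴴ Z)`. -/
def mip {n : ℕ} (Y Z : Mat n) : ℝ := ((Yᴴ * Z).trace).re

/-- The norm associated to `mip` (Frobenius norm). -/
def mnorm {n : ℕ} (Y : Mat n) : ℝ := Real.sqrt (mip Y Y)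

/-- Regular subgradient of `h` at `X` (requires `h X` finite). -/
def RegSubgrad {n : ℕ} (h : Mat n → EReal) (X Y : Mat n) : Prop :=
  h X ≠ ⊤ ∧ h X ≠ ⊥ ∧
  ∀ ε : ℝ, 0 < ε → ∃ δ : ℝ, 0 < δ ∧ ∀ Z : Mat n, mnorm (Z - X) < δ →
    (((h X).toReal + mip Y (Z - X) - ε * mnorm (Z - X) : ℝ) : EReal) ≤ h Z

/-- Limiting subgradient. -/
def LimSubgrad {n : ℕ} (h : Mat n → EReal) (X Y : Mat n) : Prop :=
  ∃ Xs Ys : ℕ → Mat n,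
    Tendsto Xs atTop (nhds X) ∧
    Tendsto (fun ν => h (Xs ν)) atTop (nhds (h X)) ∧
    (∀ ν, RegSubgrad h (Xs ν) (Ys ν)) ∧
    Tendsto Ys atTop (nhds Y)

/-- Horizon subgradient. -/
def HorSubgrad {n : ℕ} (h : Mat n → EReal) (X Y : Mat n) : Prop :=
  ∃ (Xs Ys : ℕ → Mat n) (ts : ℕ → ℝ),
    Tendsto Xs atTop (nhds X) ∧
    Tendsto (fun ν => h (Xs ν)) atTop (nhds (h X)) ∧
    (∀ ν, RegSubgrad h (Xs ν) (Ys ν)) ∧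
    (∀ ν, 0 < ts ν) ∧ Tendsto ts atTop (nhds (0 : ℝ)) ∧
    Tendsto (fun ν => ts ν • Ys ν) atTop (nhds Y)

/-- The horizon cone of a set of matrices. -/
def HorizonCone {n : ℕ} (S : Set (Mat n)) : Set (Mat n) :=
  {Y | ∃ (xs : ℕ → Mat n) (ts : ℕ → ℝ),
    (∀ ν, xs ν ∈ S) ∧ (∀ ν, 0 < ts ν) ∧ Tendsto ts atTop (nhds (0 : ℝ)) ∧
    Tendsto (fun ν => ts ν • xs ν) atTop (nhds Y)}

/-- `h` is subdifferentially regular at `X`. -/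
def SubdiffRegular {n : ℕ} (h : Mat n → EReal) (X : Mat n) : Prop :=
  {Y | LimSubgrad h X Y} = {Y | RegSubgrad h X Y} ∧
  {Y | HorSubgrad h X Y} = HorizonCone {Y | RegSubgrad h X Y}

/-- Real inner product on `ℂ`: `Re (conj y * z)`. -/
def rIP (y z : ℂ) : ℝ := ((starRingEnd ℂ) y * z).re

/-- `f` is differentiable in the real sense at `lam` with gradient `g0`. -/
def HasRGrad (f : ℂ → EReal) (g0 lam : ℂ) : Prop :=
  (∀ᶠ z in nhds lam, f z ≠ ⊤ ∧ f z ≠ ⊥) ∧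
  (fun δ : ℂ => (f (lam + δ)).toReal - (f lam).toReal - rIP g0 δ)
    =o[nhds (0 : ℂ)] (fun δ => ‖δ‖)

/-- `f` is twice differentiable in the real sense at `lam`, with gradient field `g`
near `lam` and Hessian `H0` at `lam`. -/
def HasRHess (f : ℂ → EReal) (g : ℂ → ℂ) (H0 : ℂ →L[ℝ] ℂ) (lam : ℂ) : Prop :=
  (∀ᶠ z in nhds lam, HasRGrad f (g z) z) ∧
  (fun δ : ℂ => g (lam + δ) - g lam - H0 δ) =o[nhds (0 : ℂ)] (fun δ => ‖δ‖)

/-- Condition (★) at `lam`, relative to the gradient field `g` and Hessian field `H`: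
either `f` is finite and twice real-differentiable everywhere with constant Hessian, or
`f` is twice real-differentiable near `lam`, `H` is continuous at `lam`, and
`H lam` is positive definite. -/
def StarAt (f : ℂ → EReal) (g : ℂ → ℂ) (H : ℂ → ℂ →L[ℝ] ℂ) (lam : ℂ) : Prop :=
  ((∀ z, f z ≠ ⊤) ∧ (∀ z, HasRHess f g (H z) z) ∧ (∀ z w : ℂ, H z = H w))
  ∨ ((∀ᶠ z in nhds lam, HasRHess f g (H z) z) ∧ ContinuousAt H lam ∧
     ∀ δ : ℂ, δ ≠ 0 → 0 < rIP δ (H lam δ))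

/-- Geometric multiplicity of `lam` as an eigenvalue of `X`: `dim ker (X - lam I)`. -/
def geomMult {n : ℕ} (X : Mat n) (lam : ℂ) : ℕ :=
  Module.finrank ℂ (LinearMap.ker (Matrix.toLin' (X - lam • (1 : Mat n))))


section PartA
open Polynomial

lemma det_aeval_aux {n : ℕ} (Z : Mat n) (p : ℂ[X]) :
    (aeval Z p).det = (Z.charpoly.roots.map (fun μ => p.eval μ)).prod := by
  have hcard : Multiset.card Z.charpoly.roots = n := by
    rw [← (IsAlgClosed.splits Z.charpoly).natDegree_eq_card_roots,
      Matrix.charpoly_natDegree_eq_dim, Fintype.card_fin]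
  have hlin : ∀ r : ℂ, (aeval Z (X - C r)).det
      = (Z.charpoly.roots.map (fun μ => (X - C r : ℂ[X]).eval μ)).prod := by
    intro r
    have h1 : (aeval Z (X - C r)) = -(Matrix.scalar (Fin n) r - Z) := by
      simp [Matrix.algebraMap_eq_diagonal, Pi.algebraMap_def, sub_eq_add_neg, add_comm]
    rw [h1, Matrix.det_neg, ← Matrix.eval_charpoly,
      (IsAlgClosed.splits Z.charpoly).eval_eq_prod_roots_of_monic Z.charpoly_monic,
      Fintype.card_fin]
    have h2 : (fun μ : ℂ => (X - C r : ℂ[X]).eval μ) = fun μ => (-1) * (r - μ) := by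
      funext μ; simp
    rw [h2, Multiset.prod_map_mul, Multiset.map_const', Multiset.prod_replicate, hcard]
  have hprod : ∀ s : Multiset ℂ, (aeval Z (s.map (fun r => X - C r)).prod).det
      = (Z.charpoly.roots.map (fun μ => ((s.map (fun r => X - C r)).prod : ℂ[X]).eval μ)).prod := by
    intro s
    induction s using Multiset.induction_on with
    | empty => simp
    | cons a s ih =>
      rw [Multiset.map_cons, Multiset.prod_cons, map_mul, Matrix.det_mul, ih, hlin]
      simp only [eval_mul]
      rw [Multiset.prod_map_mul]
  have h := (IsAlgClosed.splits p).eq_prod_roots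
  generalize p.leadingCoeff = c at h
  generalize p.roots = s at h
  subst h
  rw [map_mul, Matrix.det_mul, hprod]
  simp only [eval_mul]
  rw [Multiset.prod_map_mul]
  congr 1
  simp [Matrix.algebraMap_eq_diagonal, Pi.algebraMap_def, hcard]

lemma roots_charpoly_aeval {n : ℕ} (Z : Mat n) (q : ℂ[X]) :
    (aeval Z q).charpoly.roots = Z.charpoly.roots.map (fun μ => q.eval μ) := by
  have h : (aeval Z q).charpoly = ((Z.charpoly.roots.map (fun μ => q.eval μ)).map
      (fun r => X - C r)).prod := by
    apply Polynomial.funext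
    intro x
    rw [Matrix.eval_charpoly]
    have h1 : Matrix.scalar (Fin n) x - aeval Z q = aeval Z (C x - q) := by
      simp [Matrix.algebraMap_eq_diagonal, Pi.algebraMap_def]
    rw [h1, det_aeval_aux, eval_multiset_prod]
    simp [Multiset.map_map]
  rw [h, roots_multiset_prod_X_sub_C]

lemma trace_aeval {n : ℕ} (Z : Mat n) (q : ℂ[X]) :
    (aeval Z q).trace = (Z.charpoly.roots.map (fun μ => q.eval μ)).sum := by
  rw [Matrix.trace_eq_sum_roots_charpoly, roots_charpoly_aeval]

lemma isEig_iff_root {n : ℕ} (Z : Mat n) (μ : ℂ) :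
    IsEigenvalue Z μ ↔ μ ∈ Z.charpoly.roots := by
  rw [mem_roots Z.charpoly_monic.ne_zero, IsRoot.def, Matrix.eval_charpoly, IsEigenvalue]
  have : Matrix.scalar (Fin n) μ = μ • (1 : Mat n) := by
    rw [Matrix.scalar_apply, Matrix.smul_one_eq_diagonal]
  rw [this]

lemma isEig_iff_vec {n : ℕ} (Z : Mat n) (μ : ℂ) :
    IsEigenvalue Z μ ↔ ∃ v : Fin n → ℂ, v ≠ 0 ∧ Z *ᵥ v = μ • v := by
  rw [IsEigenvalue, ← Matrix.exists_mulVec_eq_zero_iff]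
  refine exists_congr fun v => and_congr_right fun _ => ?_
  rw [Matrix.sub_mulVec, Matrix.smul_mulVec, Matrix.one_mulVec, sub_eq_zero, eq_comm]

lemma aeval_mulVec_eig {n : ℕ} (Z : Mat n) (μ : ℂ) (v : Fin n → ℂ) (h : Z *ᵥ v = μ • v)
    (p : ℂ[X]) : (aeval Z p) *ᵥ v = p.eval μ • v := by
  induction p using Polynomial.induction_on' with
  | add p q hp hq => rw [map_add, Matrix.add_mulVec, hp, hq, eval_add, add_smul]
  | monomial k a =>
    have hk : ∀ k : ℕ, (Z ^ k) *ᵥ v = μ ^ k • v := by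
      intro k
      induction k with
      | zero => simp
      | succ k ih => rw [pow_succ, ← Matrix.mulVec_mulVec, h, Matrix.mulVec_smul, ih, smul_smul,
                        pow_succ, mul_comm]
    rw [aeval_monomial, ← Algebra.smul_def, Matrix.smul_mulVec, hk, smul_smul, eval_monomial]

/-- eigenvalues of a matrix annihilated by a polynomial are roots -/
lemma eig_root_of_aeval {n : ℕ} (Z : Mat n) (μ : ℂ) (h : IsEigenvalue Z μ)
    (p : ℂ[X]) (hp : aeval Z p = 0) : p.eval μ = 0 := by
  obtain ⟨v, hv, hZ⟩ := (isEig_iff_vec Z μ).1 h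
  have := aeval_mulVec_eig Z μ v hZ p
  rw [hp, Matrix.zero_mulVec] at this
  exact (smul_eq_zero.1 this.symm).resolve_right hv

lemma exists_eig {n : ℕ} (hn : 1 ≤ n) (Z : Mat n) : ∃ μ, IsEigenvalue Z μ := by
  have : (Z.charpoly).degree ≠ 0 := by
    rw [Matrix.charpoly_degree_eq_dim, Fintype.card_fin]
    exact_mod_cast (by omega : n ≠ 0)
  obtain ⟨x, hx⟩ := IsAlgClosed.exists_root _ this
  exact ⟨x, (isEig_iff_root Z x).2 ((mem_roots Z.charpoly_monic.ne_zero).2 hx)⟩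

lemma eig_update {n : ℕ} (Z : Mat n) (lam : ℂ) (v l : Fin n → ℂ) (hv : Z *ᵥ v = lam • v)
    (hv0 : v ≠ 0) (hl : l ⬝ᵥ v = 0) (s : ℂ) (μ : ℂ)
    (h : IsEigenvalue (Z + s • Matrix.vecMulVec v l) μ) : IsEigenvalue Z μ := by
  rw [isEig_iff_vec] at h ⊢
  obtain ⟨w, hw, hZw⟩ := h
  by_cases hμ : μ = lam
  · exact ⟨v, hv0, hμ ▸ hv⟩
  rw [Matrix.add_mulVec, Matrix.smul_mulVec, Matrix.vecMulVec_mulVec] at hZw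
  have hne : lam - μ ≠ 0 := sub_ne_zero.2 (Ne.symm hμ)
  set α := s * (l ⬝ᵥ w) / (lam - μ) with hα
  have hα' : α * lam = μ * α + s * (l ⬝ᵥ w) := by
    rw [hα]; field_simp; ring
  have hZw' : Z *ᵥ w = μ • w - (s * (l ⬝ᵥ w)) • v := by
    rw [← hZw, op_smul_eq_smul, smul_smul]; abel
  refine ⟨w + α • v, ?_, ?_⟩
  · intro h0
    have hwv : w = -(α • v) := eq_neg_of_add_eq_zero_left h0
    have hlw : l ⬝ᵥ w = 0 := by rw [hwv, dotProduct_neg, dotProduct_smul, hl]; simp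
    have : α = 0 := by rw [hα, hlw]; simp
    rw [this] at hwv
    exact hw (by simpa using hwv)
  · rw [Matrix.mulVec_add, Matrix.mulVec_smul, hZw', hv, smul_smul, hα', smul_add, smul_smul,
      add_smul]
    abel

end PartA

section PartB

/-- A projector commuting with `A`, onto a piece of the generalized null space of `A`,
and not acting as a scalar on the null space. -/
lemma exists_proj {n : ℕ} (A : Mat n)
    (hker : 2 ≤ Module.finrank ℂ (LinearMap.ker (Matrix.toLin' A))) :
    ∃ (P : Mat n) (k : ℕ) (v l : Fin n → ℂ), 1 ≤ k ∧ P * P = P ∧ A * P = P * A ∧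
      A ^ k * P = 0 ∧ P.trace = (k : ℂ) ∧ v ≠ 0 ∧ A *ᵥ v = 0 ∧ l ⬝ᵥ v = 0 ∧
      l ⬝ᵥ (P *ᵥ v) = 1 := by
  classical
  set T := Matrix.toLin' A with hT
  have hTpow : ∀ k x, (T ^ k) x = (A ^ k) *ᵥ x := by
    intro k x
    rw [hT, ← Matrix.toLin'_pow, Matrix.toLin'_apply]
  have hT1 : ∀ x, T x = A *ᵥ x := fun x => by rw [hT, Matrix.toLin'_apply]
  -- minimal exponent
  have hex : ∃ k, ¬ (LinearMap.ker T ≤ LinearMap.range (T ^ k)) := by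
    obtain ⟨N, hN⟩ := (Module.End.eventually_disjoint_ker_pow_range_pow T).exists_forall_of_atTop
    refine ⟨N + 1, fun hle => ?_⟩
    have hd := hN (N + 1) (by omega)
    have hk1 : LinearMap.ker T ≤ LinearMap.ker (T ^ (N + 1)) := by
      intro x hx
      rw [LinearMap.mem_ker] at hx ⊢
      rw [pow_succ, Module.End.mul_apply, hx, map_zero]
    have hbot : LinearMap.ker T = ⊥ := by
      rw [eq_bot_iff]; exact hd hk1 hle
    rw [hbot] at hker
    simp at hker
  obtain ⟨j, hj⟩ : ∃ j, Nat.find hex = j + 1 := by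
    refine Nat.exists_eq_succ_of_ne_zero fun h0 => ?_
    have := Nat.find_spec hex
    rw [h0] at this
    apply this
    simp [Module.End.one_eq_id]
  have hmin : LinearMap.ker T ≤ LinearMap.range (T ^ j) := by
    by_contra hc
    have := Nat.find_min' hex hc
    omega
  have hspec : ¬ (LinearMap.ker T ≤ LinearMap.range (T ^ (j + 1))) := hj ▸ Nat.find_spec hex
  obtain ⟨v1, hv1, hv1r⟩ := SetLike.not_le_iff_exists.1 hspec
  obtain ⟨u, hu⟩ := hmin hv1
  rw [LinearMap.mem_ker] at hv1
  have hu0 : ∀ p, j < p → (T ^ p) u = 0 := by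
    intro p hp
    obtain ⟨q, rfl⟩ : ∃ q, p = q + 1 + j := ⟨p - j - 1, by omega⟩
    rw [pow_add, Module.End.mul_apply, hu, pow_succ, Module.End.mul_apply, hv1, map_zero]
  -- the functional
  have hnot : v1 ∉ LinearMap.range (T ^ (j + 1)) ⊔
      Submodule.span ℂ (Set.range (fun i : Fin j => (T ^ (i : ℕ)) u)) := by
    intro hmem
    obtain ⟨y, ⟨y', rfl⟩, z, hz, hyz⟩ := Submodule.mem_sup.1 hmem
    obtain ⟨c, hc⟩ := (Submodule.mem_span_range_iff_exists_fun ℂ).1 hz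
    have key : ∀ m : ℕ, ∀ i : Fin j, (i : ℕ) = m → c i = 0 := by
      intro m
      induction m using Nat.strong_induction_on with
      | _ m ih =>
        intro i hi
        by_contra hci
        have h1 := congrArg (T ^ (j - m)) hyz
        have hmj : m < j := hi ▸ i.2
        have h2 : (T ^ (j - m)) v1 = 0 := by
          rw [show j - m = (j - m - 1) + 1 by omega, pow_succ, Module.End.mul_apply, hv1, map_zero]
        have h3 : (T ^ (j - m)) z = c i • v1 := by
          rw [← hc, map_sum, Finset.sum_eq_single i]
          · rw [map_smul, ← Module.End.mul_apply, ← pow_add, hi, Nat.sub_add_cancel hmj.le, hu]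
          · intro b _ hb
            rw [map_smul]
            rcases lt_trichotomy (b : ℕ) m with h | h | h
            · rw [ih _ h b rfl, zero_smul]
            · exact absurd (Fin.ext (h.trans hi.symm)) hb
            · rw [← Module.End.mul_apply, ← pow_add, hu0 _ (by omega), smul_zero]
          · simp
        rw [map_add, h2, h3] at h1
        apply hv1r
        refine ⟨(-(c i)⁻¹) • (T ^ (j - m)) y', ?_⟩
        have h4 : (T ^ (j + 1)) ((T ^ (j - m)) y') = (T ^ (j - m)) ((T ^ (j + 1)) y') := by
          rw [← Module.End.mul_apply, ← Module.End.mul_apply, ← pow_add, ← pow_add, add_comm]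
        rw [map_smul, h4, eq_neg_of_add_eq_zero_left h1, smul_neg, neg_smul, neg_neg, smul_smul,
          inv_mul_cancel₀ hci, one_smul]
    have hz0 : z = 0 := by
      rw [← hc]
      exact Finset.sum_eq_zero fun i _ => by rw [key i i rfl, zero_smul]
    rw [hz0, add_zero] at hyz
    exact hv1r ⟨y', hyz⟩
  have hfun : ∀ (p : Submodule ℂ (Fin n → ℂ)) (x : Fin n → ℂ), x ∉ p →
      ∃ l : Fin n → ℂ, l ⬝ᵥ x = 1 ∧ ∀ y ∈ p, l ⬝ᵥ y = 0 := by
    intro p x hx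
    obtain ⟨F, hF, hpF⟩ := Submodule.exists_le_ker_of_notMem hx
    have hrep : ∀ y, ((dotProductEquiv ℂ (Fin n)).symm F) ⬝ᵥ y = F y := by
      intro y
      conv_rhs => rw [← (dotProductEquiv ℂ (Fin n)).apply_symm_apply F]
      rfl
    refine ⟨(F x)⁻¹ • (dotProductEquiv ℂ (Fin n)).symm F, ?_, ?_⟩
    · rw [smul_dotProduct, hrep, smul_eq_mul, inv_mul_cancel₀ hF]
    · intro y hy
      rw [smul_dotProduct, hrep, LinearMap.mem_ker.1 (hpF hy), smul_zero]
  obtain ⟨l0, hl1, hl0⟩ := hfun _ _ hnot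
  have hlu : ∀ p, l0 ⬝ᵥ ((A ^ p) *ᵥ u) = if p = j then 1 else 0 := by
    intro p
    rw [← hTpow]
    split_ifs with h
    · rw [h, hu, hl1]
    · rcases lt_or_gt_of_ne h with h | h
      · exact hl0 _ (Submodule.mem_sup_right (Submodule.subset_span ⟨⟨p, h⟩, rfl⟩))
      · rw [hu0 p h, dotProduct_zero]
  have hlA : l0 ᵥ* (A ^ (j + 1)) = 0 := by
    apply dotProduct_eq
    intro w
    rw [← Matrix.dotProduct_mulVec, zero_dotProduct, ← hTpow]
    exact hl0 _ (Submodule.mem_sup_left ⟨w, rfl⟩)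
  have hAu : (A ^ (j + 1)) *ᵥ u = 0 := by rw [← hTpow, hu0 _ (by omega)]
  have hAv1 : A *ᵥ v1 = 0 := by rw [← hT1, hv1]
  set P : Mat n := ∑ i ∈ Finset.range (j + 1),
    Matrix.vecMulVec ((A ^ i) *ᵥ u) (l0 ᵥ* (A ^ (j - i))) with hP
  have hPv : ∀ x, P *ᵥ x = ∑ i ∈ Finset.range (j + 1),
      (l0 ⬝ᵥ ((A ^ (j - i)) *ᵥ x)) • ((A ^ i) *ᵥ u) := by
    intro x
    rw [hP, Matrix.sum_mulVec]
    refine Finset.sum_congr rfl fun i _ => ?_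
    rw [Matrix.vecMulVec_mulVec, op_smul_eq_smul, Matrix.dotProduct_mulVec]
  have hPu : ∀ i ∈ Finset.range (j + 1), P *ᵥ ((A ^ i) *ᵥ u) = (A ^ i) *ᵥ u := by
    intro i hi
    rw [Finset.mem_range] at hi
    rw [hPv, Finset.sum_eq_single i]
    · rw [Matrix.mulVec_mulVec, ← pow_add, hlu, if_pos (by omega), one_smul]
    · intro b hb hbi
      rw [Finset.mem_range] at hb
      rw [Matrix.mulVec_mulVec, ← pow_add, hlu, if_neg (by omega), zero_smul]
    · intro h; exact absurd (Finset.mem_range.2 hi) h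
  -- second kernel vector
  obtain ⟨v2, hv2, hv20, hlv2⟩ : ∃ v2, A *ᵥ v2 = 0 ∧ v2 ≠ 0 ∧ l0 ⬝ᵥ v2 = 0 := by
    let F : LinearMap.ker T →ₗ[ℂ] ℂ := (dotProductEquiv ℂ (Fin n) l0).comp (LinearMap.ker T).subtype
    have hF : LinearMap.ker F ≠ ⊥ := LinearMap.ker_ne_bot_of_finrank_lt (by
      rw [Module.finrank_self]; omega)
    obtain ⟨x, hx, hx0⟩ := Submodule.exists_mem_ne_zero_of_ne_bot hF
    refine ⟨x, ?_, ?_, ?_⟩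
    · rw [← hT1]; exact x.2
    · simpa using hx0
    · exact hx
  have hPker : ∀ x, A *ᵥ x = 0 → P *ᵥ x = (l0 ⬝ᵥ x) • v1 := by
    intro x hx
    rw [hPv, Finset.sum_eq_single j]
    · rw [Nat.sub_self, pow_zero, Matrix.one_mulVec, ← hu, hTpow]
    · intro b hb hbj
      rw [Finset.mem_range] at hb
      rw [show j - b = (j - b - 1) + 1 by omega, pow_succ, ← Matrix.mulVec_mulVec, hx,
        Matrix.mulVec_zero, dotProduct_zero, zero_smul]
    · simp
  have hlv : l0 ⬝ᵥ (v1 + v2) = 1 := by rw [dotProduct_add, hl1, hlv2, add_zero]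
  have hAv : A *ᵥ (v1 + v2) = 0 := by rw [Matrix.mulVec_add, hAv1, hv2, add_zero]
  have hv1span : v1 ∉ Submodule.span ℂ {v1 + v2} := by
    intro h
    obtain ⟨c, hc⟩ := Submodule.mem_span_singleton.1 h
    have h1 := congrArg (fun x => l0 ⬝ᵥ x) hc
    simp only [dotProduct_smul, hlv, hl1, smul_eq_mul, mul_one] at h1
    rw [h1, one_smul] at hc
    exact hv20 (by simpa using hc)
  obtain ⟨l, hl, hl'⟩ := hfun _ _ hv1span
  refine ⟨P, j + 1, v1 + v2, l, by omega, ?_, ?_, ?_, ?_, ?_, hAv, ?_, ?_⟩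
  · conv_lhs => rw [hP, Finset.mul_sum]
    conv_rhs => rw [hP]
    refine Finset.sum_congr rfl fun i hi => ?_
    rw [Matrix.mul_vecMulVec, hPu i hi]
  · rw [hP, Finset.mul_sum, Finset.sum_mul]
    have e1 : ∀ i, A * Matrix.vecMulVec ((A ^ i) *ᵥ u) (l0 ᵥ* (A ^ (j - i)))
        = Matrix.vecMulVec ((A ^ (i + 1)) *ᵥ u) (l0 ᵥ* (A ^ (j - i))) := by
      intro i
      rw [Matrix.mul_vecMulVec, Matrix.mulVec_mulVec, ← pow_succ']
    have e2 : ∀ i, Matrix.vecMulVec ((A ^ i) *ᵥ u) (l0 ᵥ* (A ^ (j - i))) * A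
        = Matrix.vecMulVec ((A ^ i) *ᵥ u) (l0 ᵥ* (A ^ (j - i + 1))) := by
      intro i
      rw [Matrix.vecMulVec_mul, Matrix.vecMul_vecMul, ← pow_succ]
    simp only [e1, e2]
    rw [Finset.sum_range_succ, Finset.sum_range_succ', hAu, Nat.sub_zero, hlA]
    rw [Matrix.zero_vecMulVec, Matrix.vecMulVec_zero]
    congr 1
    refine Finset.sum_congr rfl fun i hi => ?_
    rw [Finset.mem_range] at hi
    rw [show j - (i + 1) + 1 = j - i by omega]
  · rw [hP, Finset.mul_sum]
    refine Finset.sum_eq_zero fun i _ => ?_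
    rw [Matrix.mul_vecMulVec, Matrix.mulVec_mulVec, ← pow_add, add_comm, pow_add,
      ← Matrix.mulVec_mulVec, hAu, Matrix.mulVec_zero, Matrix.zero_vecMulVec]
  · rw [hP, Matrix.trace_sum]
    have : ∀ i ∈ Finset.range (j + 1),
        (Matrix.vecMulVec ((A ^ i) *ᵥ u) (l0 ᵥ* (A ^ (j - i)))).trace = 1 := by
      intro i hi
      rw [Finset.mem_range] at hi
      rw [Matrix.trace_vecMulVec, dotProduct_comm, ← Matrix.dotProduct_mulVec,
        Matrix.mulVec_mulVec, ← pow_add, hlu, if_pos (by omega)]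
    rw [Finset.sum_congr rfl this]
    simp
  · intro h
    rw [h, dotProduct_zero] at hlv
    exact zero_ne_one hlv
  · exact hl' _ (Submodule.mem_span_singleton_self _)
  · rw [hPker _ hAv, hlv, one_smul, hl]

end PartB

section PartC
open Polynomial
open scoped Matrix.Norms.Frobenius

lemma mnorm_eq {n : ℕ} (Y : Mat n) : mnorm Y = ‖Y‖ := by
  rw [Matrix.frobenius_norm_def, mnorm, mip, Real.sqrt_eq_rpow]
  congr 1
  rw [Matrix.trace, Complex.re_sum, Finset.sum_comm]
  refine Finset.sum_congr rfl fun i _ => ?_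
  rw [Matrix.diag_apply, Matrix.mul_apply, Complex.re_sum]
  refine Finset.sum_congr rfl fun j _ => ?_
  rw [Matrix.conjTranspose_apply, Real.rpow_two, ← Complex.normSq_eq_norm_sq]
  simp [Complex.normSq_apply]

lemma commute_aeval {n : ℕ} (Z0 W : Mat n) (h : Commute Z0 W) (p : ℂ[X]) :
    Commute (aeval Z0 p) W := by
  induction p using Polynomial.induction_on' with
  | add p q hp hq => rw [map_add]; exact hp.add_left hq
  | monomial k a =>
    rw [aeval_monomial]
    exact (Algebra.commute_algebraMap_left a W).mul_left (h.pow_left k)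

/-- `Z ↦ p(Z)` is differentiable, and its derivative has the expected traces. -/
def HasPolyDeriv {n : ℕ} (Z0 : Mat n) (p : ℂ[X]) : Prop :=
  ∃ L : Mat n →L[ℂ] Mat n, HasFDerivAt (fun Z : Mat n => aeval Z p) L Z0 ∧
      ∀ W : Mat n, Commute Z0 W → ∀ H : Mat n,
        (L H * W).trace = (aeval Z0 (derivative p) * W * H).trace

lemma HasPolyDeriv.mul {n : ℕ} {Z0 : Mat n} {p q : ℂ[X]} (h1 : HasPolyDeriv Z0 p)
    (h2 : HasPolyDeriv Z0 q) : HasPolyDeriv Z0 (p * q) := by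
  obtain ⟨Lp, hp, hp'⟩ := h1
  obtain ⟨Lq, hq, hq'⟩ := h2
  have h := hp.mul' hq
  have e : ((fun Z : Mat n => aeval Z p) * fun Z : Mat n => aeval Z q)
      = fun Z : Mat n => aeval Z (p * q) := by
    funext Z; simp
  rw [e] at h
  refine ⟨_, h, ?_⟩
  intro W hW H
  change ((aeval Z0 p * Lq H + Lp H * aeval Z0 q) * W).trace = _
  rw [add_mul, Matrix.trace_add, derivative_mul, map_add, map_mul, map_mul, add_mul, add_mul,
    Matrix.trace_add]
  have c1 : Commute Z0 (W * aeval Z0 p) := hW.mul_right (commute_aeval Z0 Z0 rfl p).symm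
  have c2 : Commute Z0 (aeval Z0 q * W) := (commute_aeval Z0 Z0 rfl q).symm.mul_right hW
  rw [mul_assoc (aeval Z0 p), Matrix.trace_mul_comm (aeval Z0 p), mul_assoc (Lq H), hq' _ c1,
    mul_assoc (Lp H), hp' _ c2]
  have c3 : aeval Z0 p * aeval Z0 (derivative q) * W = aeval Z0 (derivative q) * (W * aeval Z0 p) := by
    rw [← (commute_aeval Z0 W hW p).eq, ← mul_assoc, ← map_mul, ← map_mul, mul_comm p]
  rw [c3, add_comm, ← mul_assoc (aeval Z0 (derivative p))]

lemma hasPolyDeriv {n : ℕ} (Z0 : Mat n) (p : ℂ[X]) : HasPolyDeriv Z0 p := by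
  have hC : ∀ a : ℂ, HasPolyDeriv Z0 (C a) := by
    intro a
    refine ⟨0, ?_, ?_⟩
    · simp only [aeval_C]
      exact hasFDerivAt_const _ _
    · intro W _ H
      simp
  have hX : HasPolyDeriv Z0 (X : ℂ[X]) := by
    refine ⟨ContinuousLinearMap.id ℂ _, ?_, ?_⟩
    · simp only [aeval_X]
      exact hasFDerivAt_id _
    · intro W _ H
      rw [derivative_X, map_one, one_mul, Matrix.trace_mul_comm]
      rfl
  induction p using Polynomial.induction_on with
  | C a => exact hC a
  | add p q hp hq =>
    obtain ⟨Lp, hp, hp'⟩ := hp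
    obtain ⟨Lq, hq, hq'⟩ := hq
    refine ⟨Lp + Lq, ?_, ?_⟩
    · simp only [map_add]
      exact hp.add hq
    · intro W hW H
      simp [add_mul, hp' W hW H, hq' W hW H]
  | monomial k a ih =>
    rw [pow_succ, ← mul_assoc]
    exact ih.mul hX

/-- The trace of `p(Z)` to first order. -/
lemma trace_aeval_littleO {n : ℕ} (Z0 : Mat n) (p : ℂ[X]) (D : Mat n)
    (hD : aeval Z0 (derivative p) = D) :
    (fun H : Mat n => (aeval (Z0 + H) p).trace - (aeval Z0 p).trace - (D * H).trace)
      =o[nhds (0 : Mat n)] (fun H : Mat n => H) := by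
  obtain ⟨L, hL, hL'⟩ := hasPolyDeriv Z0 p
  have h1 := hasFDerivAt_iff_isLittleO_nhds_zero.1 hL
  let T : Mat n →L[ℂ] ℂ := (Matrix.traceLinearMap (Fin n) ℂ ℂ).toContinuousLinearMap
  have h2 := (T.isBigO_comp (fun H : Mat n => aeval (Z0 + H) p - aeval Z0 p - L H)
    (nhds 0)).trans_isLittleO h1
  refine h2.congr_left ?_
  intro H
  have := hL' 1 (Commute.one_right _) H
  rw [mul_one, mul_one, hD] at this
  change Matrix.trace (aeval (Z0 + H) p - aeval Z0 p - L H) = _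
  rw [Matrix.trace_sub, Matrix.trace_sub, this]

lemma aeval_bigO {n : ℕ} (Z0 : Mat n) (p : ℂ[X]) (h0 : aeval Z0 p = 0) :
    (fun H : Mat n => aeval (Z0 + H) p) =O[nhds (0 : Mat n)] (fun H : Mat n => H) := by
  obtain ⟨L, hL, -⟩ := hasPolyDeriv Z0 p
  have h1 := (hasFDerivAt_iff_isLittleO_nhds_zero.1 hL).isBigO.add (L.isBigO_id (nhds 0))
  refine h1.congr_left ?_
  intro H
  rw [h0]; abel

lemma norm_eval_le {n : ℕ} (Z : Mat n) (μ : ℂ) (h : IsEigenvalue Z μ) (p : ℂ[X]) :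
    ‖p.eval μ‖ ≤ ‖aeval Z p‖ * ‖(1 : Mat n)‖ := by
  apply spectrum.norm_le_norm_mul_of_mem (𝕜 := ℂ)
  apply spectrum.subset_polynomial_aeval
  refine ⟨μ, ?_, rfl⟩
  rw [Matrix.mem_spectrum_iff_isRoot_charpoly, ← Polynomial.mem_roots Z.charpoly_monic.ne_zero]
  exact (isEig_iff_root Z μ).1 h

lemma pointwise_aux (x R : ℂ) (e η B : ℝ) (he : 0 ≤ e) (_hη : 0 ≤ η) (hx : x.re ≤ -e)
    (hB : ‖x‖ ≤ B) (hR : ‖R * (1 - R)‖ ≤ η / 2) :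
    (x * R).re + e * R.re ≤ (B + e) * η := by
  have hB0 : 0 ≤ B := (norm_nonneg _).trans hB
  rw [norm_mul] at hR
  have h1 : 1 ≤ ‖R‖ + ‖1 - R‖ := by
    calc (1 : ℝ) = ‖R + (1 - R)‖ := by simp
      _ ≤ _ := norm_add_le _ _
  have n1 := norm_nonneg R
  have n2 := norm_nonneg (1 - R)
  have hcase : ‖R‖ ≤ η ∨ ‖1 - R‖ ≤ η := by
    rcases le_total ‖R‖ (1/2) with h | h
    · left; nlinarith
    · right; nlinarith
  rcases hcase with h | h
  · have a1 : (x * R).re ≤ B * η := by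
      calc (x * R).re ≤ ‖x * R‖ := Complex.re_le_norm _
        _ = ‖x‖ * ‖R‖ := norm_mul _ _
        _ ≤ B * η := by gcongr
    have a2 : R.re ≤ η := (Complex.re_le_norm _).trans h
    nlinarith
  · have a0 : (x * R).re = x.re - (x * (1 - R)).re := by
      rw [← Complex.sub_re]; ring_nf
    have a1 : -(x * (1 - R)).re ≤ B * η := by
      calc -(x * (1 - R)).re ≤ |(x * (1 - R)).re| := neg_le_abs _
        _ ≤ ‖x * (1 - R)‖ := Complex.abs_re_le_norm _
        _ = ‖x‖ * ‖1 - R‖ := norm_mul _ _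
        _ ≤ B * η := by gcongr
    have a2 : R.re ≤ 1 + η := by
      have : R.re = 1 - (1 - R).re := by simp
      have h3 := (abs_le.1 ((Complex.abs_re_le_norm (1 - R)).trans h)).1
      linarith
    nlinarith

lemma multiset_aux (s : Multiset ℂ) (x R : ℂ → ℂ) (e c : ℝ)
    (h : ∀ μ ∈ s, (x μ * R μ).re + e * (R μ).re ≤ c) :
    ((s.map (fun μ => x μ * R μ)).sum).re + e * ((s.map R).sum).re ≤ Multiset.card s * c := by
  induction s using Multiset.induction_on with
  | empty => simp
  | cons a s ih =>
    have h1 := h a (Multiset.mem_cons_self a s)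
    have h2 := ih fun μ hμ => h μ (Multiset.mem_cons_of_mem hμ)
    simp only [Multiset.map_cons, Multiset.sum_cons, Complex.add_re, Multiset.card_cons]
    push_cast
    linarith

set_option maxHeartbeats 1000000 in
/-- First-order lower bound for the eigenvalues near an isolated group of eigenvalues. -/
lemma key_eig {n : ℕ} (Z0 P : Mat n) (lam : ℂ) (k : ℕ) (b : ℂ[X]) (hk : 1 ≤ k)
    (hcomm : Z0 * P = P * Z0)
    (hN : (Z0 - lam • (1 : Mat n)) ^ k * P = 0) (hb : aeval Z0 b * (1 - P) = 0)
    (hbl : b.eval lam ≠ 0) (htr : P.trace = (k : ℂ)) (g : ℂ) (ε : ℝ) (hε : 0 < ε) :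
    ∃ δ : ℝ, 0 < δ ∧ ∀ H : Mat n, ‖H‖ < δ → H ≠ 0 → ∃ μ, IsEigenvalue (Z0 + H) μ ∧
      (star g * (P * H).trace / k).re - ε * ‖H‖ ≤ (star g * (μ - lam)).re := by
  -- Bezout
  obtain ⟨a1, ha1⟩ : ∃ a1 : ℂ[X], a1 = (X - C lam) ^ k := ⟨_, rfl⟩
  have hcop : IsCoprime (a1 * a1) (b * b) := by
    have h0 : IsCoprime (X - C lam) b := by
      rw [(Polynomial.irreducible_X_sub_C lam).coprime_iff_not_dvd, dvd_iff_isRoot]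
      exact hbl
    have h1 : IsCoprime a1 b := ha1 ▸ h0.pow_left
    exact (h1.mul_left h1).mul_right (h1.mul_left h1)
  obtain ⟨u, w, huw⟩ := hcop
  obtain ⟨R, hR⟩ : ∃ R : ℂ[X], R = w * (b * b) := ⟨_, rfl⟩
  obtain ⟨q, hq⟩ : ∃ q : ℂ[X], q = (X - C lam) * R := ⟨_, rfl⟩
  have hR1 : R = 1 - u * (a1 * a1) := by rw [← huw, hR]; ring
  have hPcomm : ∀ p : ℂ[X], aeval Z0 p * P = P * aeval Z0 p := fun p => commute_aeval Z0 P hcomm p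
  have hA : aeval Z0 (X - C lam) = Z0 - lam • (1 : Mat n) := by
    rw [map_sub, aeval_X, aeval_C, Algebra.algebraMap_eq_smul_one]
  have hA1 : aeval Z0 a1 * P = 0 := by rw [ha1, map_pow, hA, hN]
  have hkillP : ∀ p : ℂ[X], aeval Z0 (p * a1) * P = 0 := fun p => by
    rw [map_mul, mul_assoc, hA1, mul_zero]
  have hkillQ : ∀ p : ℂ[X], aeval Z0 (p * b) * (1 - P) = 0 := fun p => by
    rw [map_mul, mul_assoc, hb, mul_zero]
  have hsplit : ∀ M : Mat n, M = M * P + M * (1 - P) := fun M => by noncomm_ring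
  have hRZ : aeval Z0 R = P := by
    rw [hsplit (aeval Z0 R)]
    have e1 : aeval Z0 R * (1 - P) = 0 := by
      rw [hR, ← mul_assoc]; exact hkillQ _
    have e2 : aeval Z0 R * P = P := by
      rw [hR1, map_sub, map_one, sub_mul, ← mul_assoc, hkillP, one_mul, sub_zero]
    rw [e1, e2, add_zero]
  have hRZ' : aeval Z0 (derivative R) = 0 := by
    rw [hsplit (aeval Z0 (derivative R))]
    have e1 : aeval Z0 (derivative R) * (1 - P) = 0 := by
      have : derivative R = (derivative w * b + 2 * w * derivative b) * b := by
        rw [hR]; simp only [derivative_mul]; ring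
      rw [this]; exact hkillQ _
    have e2 : aeval Z0 (derivative R) * P = 0 := by
      have : derivative R = (-(derivative u * a1 + 2 * u * derivative a1)) * a1 := by
        rw [hR1]; simp only [derivative_mul, derivative_sub, derivative_one]; ring
      rw [this]; exact hkillP _
    rw [e1, e2, add_zero]
  have hqZ' : aeval Z0 (derivative q) = P := by
    rw [hq, derivative_mul, map_add, map_mul, map_mul (aeval Z0) _ (derivative R), hRZ, hRZ']
    simp
  have hqtr : (aeval Z0 q).trace = 0 := by
    have : IsNilpotent (aeval Z0 q) := by
      refine ⟨k, ?_⟩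
      rw [← map_pow, hq, mul_pow, ← ha1, map_mul, map_pow (aeval Z0) R, hRZ]
      rw [show k = (k - 1) + 1 by omega, pow_succ', ← mul_assoc, hA1, zero_mul]
    exact (Matrix.isNilpotent_trace_of_isNilpotent this).eq_zero
  have haZ : aeval Z0 (a1 * b) = 0 := by
    rw [hsplit (aeval Z0 (a1 * b)), hkillQ, mul_comm, hkillP, add_zero]
  -- asymptotics
  have oq := trace_aeval_littleO Z0 q P hqZ'
  have oR := trace_aeval_littleO Z0 R 0 hRZ'
  obtain ⟨Ca, hCa0, hCa⟩ := (aeval_bigO Z0 (a1 * b) haZ).exists_pos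
  obtain ⟨Ct, hCt0, hCt⟩ : ∃ Ct : ℝ, 0 ≤ Ct ∧ ∀ H : Mat n, ‖(P * H).trace‖ ≤ Ct * ‖H‖ := by
    let T : Mat n →L[ℂ] ℂ :=
      ((Matrix.traceLinearMap (Fin n) ℂ ℂ).comp (LinearMap.mulLeft ℂ P)).toContinuousLinearMap
    obtain ⟨Cc, hC0, hC⟩ := T.bound
    exact ⟨Cc, hC0.le, hC⟩
  -- bound for eigenvalues and for `u * w` on them
  set M0 : ℝ := (‖Z0‖ + 1) * ‖(1 : Mat n)‖ with hM0
  obtain ⟨Cu, hCu⟩ := (isCompact_closedBall (0 : ℂ) M0).exists_bound_of_continuousOn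
    (f := fun z => (u * w).eval z) (Polynomial.continuous _).continuousOn
  set Cu' := max Cu 0 with hCu'
  set E1 := ‖(1 : Mat n)‖ with hE1
  set K : ℝ := Cu' * (Ca * E1) ^ 2 with hK
  set B : ℝ := ‖g‖ * (M0 + ‖lam‖ + Ct) with hB
  set S : ℝ := ‖g‖ * Ct + n * ((B + ε) * (2 * K)) with hS
  have hE10 : 0 ≤ E1 := norm_nonneg _
  have hM00 : 0 ≤ M0 := by positivity
  have hCu0 : 0 ≤ Cu' := le_max_right _ _
  have hK0 : 0 ≤ K := by positivity
  have hB0 : 0 ≤ B := by positivity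
  have hS0 : 0 ≤ S := by positivity
  have ev1 := oq.def (c := ε / (8 * (‖g‖ + 1))) (by positivity)
  have ev2 := oR.def (c := 1) one_pos
  have ev := (ev1.and (ev2.and hCa.bound))
  obtain ⟨δ1, hδ1, hev⟩ := Metric.eventually_nhds_iff.1 ev
  refine ⟨min δ1 (min (1/4) (ε / (8 * (S + 1)))), by positivity, ?_⟩
  intro H hH hH0
  obtain ⟨hHδ, hH4, hHS⟩ : ‖H‖ < δ1 ∧ ‖H‖ < 1/4 ∧ ‖H‖ < ε / (8 * (S + 1)) := by
    simpa [lt_min_iff] using hH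
  have hHd : dist H 0 < δ1 := by rw [dist_eq_norm, sub_zero]; exact hHδ
  obtain ⟨b1, b2, b3⟩ := hev hHd
  have hHpos : 0 < ‖H‖ := norm_pos_iff.2 hH0
  by_contra hcon
  push Not at hcon
  set c : ℂ := (P * H).trace / k with hc
  have hk1 : (1 : ℝ) ≤ k := by exact_mod_cast hk
  have hkc : (k : ℂ) ≠ 0 := by exact_mod_cast (by omega : k ≠ 0)
  have hcn : ‖c‖ ≤ Ct * ‖H‖ := by
    rw [hc, norm_div, Complex.norm_natCast]
    exact (div_le_self (norm_nonneg _) hk1).trans (hCt H)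
  have hcard : Multiset.card (Z0 + H).charpoly.roots = n := by
    rw [← (IsAlgClosed.splits (Z0 + H).charpoly).natDegree_eq_card_roots,
      Matrix.charpoly_natDegree_eq_dim, Fintype.card_fin]
  have main := multiset_aux (Z0 + H).charpoly.roots (fun μ => star g * (μ - lam - c))
    (fun μ => R.eval μ) (ε * ‖H‖) ((B + ε * ‖H‖) * (2 * K * ‖H‖ ^ 2)) (by
      intro μ hμ
      have hμE := (isEig_iff_root _ _).2 hμ
      have hμn : ‖μ‖ ≤ M0 := by
        have := norm_eval_le _ _ hμE X
        rw [eval_X, aeval_X] at this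
        refine this.trans ?_
        rw [hM0]
        gcongr
        exact (norm_add_le _ _).trans (by linarith)
      apply pointwise_aux
      · positivity
      · positivity
      · have h1 := hcon μ hμE
        have h2 : star g * (μ - lam - c) = star g * (μ - lam) - star g * (P * H).trace / k := by
          rw [hc]; ring
        rw [h2, Complex.sub_re]
        linarith
      · rw [norm_mul, norm_star, hB]
        gcongr
        calc ‖μ - lam - c‖ ≤ ‖μ - lam‖ + ‖c‖ := norm_sub_le _ _
          _ ≤ ‖μ‖ + ‖lam‖ + ‖c‖ := by gcongr; exact norm_sub_le _ _
          _ ≤ M0 + ‖lam‖ + Ct := by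
            gcongr
            refine hcn.trans ?_
            nlinarith
      · have h1 : R.eval μ * (1 - R.eval μ) = (u * w).eval μ * ((a1 * b).eval μ) ^ 2 := by
          have : R * (1 - R) = (u * w) * (a1 * b) ^ 2 := by
            have h5 : 1 - R = u * (a1 * a1) := by rw [hR1]; ring
            rw [h5, hR]; ring
          have h3 := congrArg (eval μ) this
          simpa only [eval_mul, eval_sub, eval_one, eval_pow] using h3
        rw [h1, norm_mul, norm_pow]
        have h2 : ‖(u * w).eval μ‖ ≤ Cu' :=
          (hCu μ (by simpa using hμn)).trans (le_max_left _ _)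
        have h3 : ‖(a1 * b).eval μ‖ ≤ (Ca * E1) * ‖H‖ := by
          refine (norm_eval_le _ _ hμE (a1 * b)).trans ?_
          calc _ ≤ (Ca * ‖H‖) * E1 := by gcongr
            _ = _ := by ring
        calc _ ≤ Cu' * ((Ca * E1) * ‖H‖) ^ 2 := by gcongr
          _ = 2 * K * ‖H‖ ^ 2 / 2 := by rw [hK]; ring)
  rw [hcard, ← trace_aeval] at main
  set τR := (aeval (Z0 + H) R).trace with hτR
  set τq := (aeval (Z0 + H) q).trace with hτq
  have hsum : ((Z0 + H).charpoly.roots.map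
      (fun μ => star g * (μ - lam - c) * R.eval μ)).sum = star g * (τq - c * τR) := by
    have e : (fun μ => star g * (μ - lam - c) * R.eval μ)
        = fun μ => (C (star g) * (q - C c * R)).eval μ := by
      funext μ
      simp only [hq, eval_mul, eval_sub, eval_C, eval_X]; ring
    rw [e, ← trace_aeval, map_mul, map_sub, map_mul, aeval_C, aeval_C,
      ← Algebra.smul_def, ← Algebra.smul_def, Matrix.trace_smul, Matrix.trace_sub,
      Matrix.trace_smul, smul_eq_mul, smul_eq_mul]
  rw [hsum] at main
  rw [hqtr, sub_zero] at b1
  rw [hRZ, htr, zero_mul, Matrix.trace_zero, sub_zero, one_mul] at b2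
  have hτRre : (k : ℝ) - ‖H‖ ≤ τR.re := by
    have h1 := (abs_le.1 ((Complex.abs_re_le_norm _).trans b2)).1
    simp only [Complex.sub_re, Complex.natCast_re] at h1
    linarith
  have hF : ‖star g * (τq - c * τR)‖ ≤ ε / 8 * ‖H‖ + ‖g‖ * Ct * ‖H‖ ^ 2 := by
    have e : τq - c * τR = (τq - (P * H).trace) - c * (τR - k) := by
      have : c * k = (P * H).trace := by rw [hc]; field_simp
      rw [← this]; ring
    rw [norm_mul, norm_star, e]
    have h1 : ‖c * (τR - k)‖ ≤ Ct * ‖H‖ * ‖H‖ := by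
      rw [norm_mul]; gcongr
    have h2 := norm_sub_le (τq - (P * H).trace) (c * (τR - k))
    have hg : ‖g‖ * (ε / (8 * (‖g‖ + 1))) ≤ ε / 8 := by
      rw [mul_div_assoc', div_le_div_iff₀ (by positivity) (by norm_num)]
      nlinarith [norm_nonneg g]
    calc ‖g‖ * _ ≤ ‖g‖ * (ε / (8 * (‖g‖ + 1)) * ‖H‖ + Ct * ‖H‖ * ‖H‖) := by
          gcongr; linarith
      _ = ‖g‖ * (ε / (8 * (‖g‖ + 1))) * ‖H‖ + ‖g‖ * Ct * ‖H‖ ^ 2 := by ring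
      _ ≤ _ := by gcongr
  have hF' := (abs_le.1 ((Complex.abs_re_le_norm _).trans hF)).1
  have m1 : ε * ‖H‖ * (3 / 4) ≤ ε * ‖H‖ * τR.re := by
    apply mul_le_mul_of_nonneg_left _ (by positivity)
    linarith
  have m2 : (n : ℝ) * ((B + ε * ‖H‖) * (2 * K * ‖H‖ ^ 2)) ≤ n * ((B + ε) * (2 * K)) * ‖H‖ ^ 2 := by
    have : B + ε * ‖H‖ ≤ B + ε := by nlinarith
    calc _ ≤ (n : ℝ) * ((B + ε) * (2 * K * ‖H‖ ^ 2)) := by gcongr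
      _ = _ := by ring
  have m3 : S * ‖H‖ ^ 2 ≤ ε / 8 * ‖H‖ := by
    rw [lt_div_iff₀ (by positivity)] at hHS
    nlinarith
  have m4 : S * ‖H‖ ^ 2 = ‖g‖ * Ct * ‖H‖ ^ 2 + n * ((B + ε) * (2 * K)) * ‖H‖ ^ 2 := by
    rw [hS]; ring
  have m5 : 0 < ε * ‖H‖ := by positivity
  nlinarith

end PartC

section PartE
open Polynomial

lemma conv_ineq (f : ℂ → EReal) (hfbot : ∀ z, f z ≠ ⊥)
    (hfconv : Convex ℝ {p : ℂ × ℝ | f p.1 ≤ (p.2 : EReal)}) (g0 lam : ℂ)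
    (h : HasRGrad f g0 lam) (μ : ℂ) :
    (((f lam).toReal + rIP g0 (μ - lam) : ℝ) : EReal) ≤ f μ := by
  obtain ⟨hfin, ho⟩ := h
  have hl := hfin.self_of_nhds
  by_cases hμ : f μ = ⊤
  · rw [hμ]; exact le_top
  obtain ⟨s, hs⟩ : ∃ s : ℝ, f μ = s := ⟨(f μ).toReal, (EReal.coe_toReal hμ (hfbot μ)).symm⟩
  obtain ⟨r, hr⟩ : ∃ r : ℝ, f lam = r := ⟨(f lam).toReal, (EReal.coe_toReal hl.1 hl.2).symm⟩
  rw [hs, EReal.coe_le_coe_iff, hr, EReal.toReal_coe]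
  rw [hr, EReal.toReal_coe] at ho
  set δ := μ - lam with hδ
  by_contra hcon
  push Not at hcon
  set x := r + rIP g0 δ - s with hx
  have hx0 : 0 < x := by linarith
  have hev := ho.def (c := x / (2 * (‖δ‖ + 1))) (by positivity)
  have ht : Tendsto (fun t : ℝ => (t : ℂ) * δ) (nhdsWithin 0 (Set.Ioi 0)) (nhds 0) := by
    have : Continuous (fun t : ℝ => (t : ℂ) * δ) := by fun_prop
    have h2 := this.tendsto 0
    simp only [Complex.ofReal_zero, zero_mul] at h2
    exact h2.mono_left nhdsWithin_le_nhds
  have hev2 := (ht.eventually hev).and (Ioo_mem_nhdsGT (zero_lt_one' ℝ))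
  obtain ⟨t, h1, ht0, ht1⟩ := hev2.exists
  have hconv := hfconv (x := (lam, r)) (y := (μ, s)) (by simp [hr]) (by simp [hs])
    (sub_nonneg.2 ht1.le) ht0.le (by ring)
  have hpt : (1 - t) • lam + t • μ = lam + (t : ℂ) * δ := by
    simp only [Complex.real_smul, hδ]; push_cast; ring
  simp only [Prod.smul_mk, Prod.mk_add_mk, Set.mem_ofPred_eq, hpt] at hconv
  have hle : (f (lam + (t : ℂ) * δ)).toReal ≤ (1 - t) • r + t • s := by
    have := EReal.toReal_le_toReal hconv (hfbot _) (EReal.coe_ne_top _)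
    rwa [EReal.toReal_coe] at this
  simp only [smul_eq_mul] at hle
  have hrip : rIP g0 ((t : ℂ) * δ) = t * rIP g0 δ := by
    simp only [rIP]
    rw [mul_left_comm, Complex.re_ofReal_mul]
  rw [hrip, norm_norm, norm_mul, Complex.norm_real, Real.norm_eq_abs, Real.norm_eq_abs,
    abs_of_pos ht0] at h1
  have h3 := (abs_le.1 h1).1
  have h4 : x / (2 * (‖δ‖ + 1)) * ‖δ‖ < x := by
    rw [div_mul_eq_mul_div, div_lt_iff₀ (by positivity)]
    nlinarith [norm_nonneg δ]
  nlinarith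

lemma mip_smul_conj {n : ℕ} (c : ℂ) (P H : Mat n) :
    mip (c • Pᴴ) H = (star c * (P * H).trace).re := by
  rw [mip, Matrix.conjTranspose_smul, Matrix.conjTranspose_conjTranspose, Matrix.smul_mul,
    Matrix.trace_smul, smul_eq_mul]

lemma pow_mul_congr {n : ℕ} (M N Q : Mat n) (h : M * Q = N * Q) (hc : N * Q = Q * N) (k : ℕ) :
    M ^ k * Q = N ^ k * Q := by
  induction k with
  | zero => simp
  | succ k ih =>
    rw [pow_succ, mul_assoc, h, hc, ← mul_assoc, ih, mul_assoc, ← hc, ← mul_assoc, ← pow_succ]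

lemma aeval_mul_congr {n : ℕ} (M N Q : Mat n) (h : M * Q = N * Q) (hc : N * Q = Q * N) (p : ℂ[X]) :
    aeval M p * Q = aeval N p * Q := by
  induction p using Polynomial.induction_on' with
  | add p q hp hq => rw [map_add, map_add, add_mul, add_mul, hp, hq]
  | monomial k a =>
    rw [aeval_monomial, aeval_monomial, mul_assoc, mul_assoc, pow_mul_congr M N Q h hc]

lemma rIP_self_mul (g0 : ℂ) (t : ℝ) : rIP g0 ((t : ℂ) * g0) = t * ‖g0‖ ^ 2 := by
  rw [rIP, mul_left_comm, Complex.re_ofReal_mul, mul_comm ((starRingEnd ℂ) g0), Complex.mul_conj,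
    Complex.ofReal_re, Complex.normSq_eq_norm_sq]

lemma reg_step {n : ℕ} (f : ℂ → EReal) (hfbot : ∀ z, f z ≠ ⊥)
    (hfconv : Convex ℝ {p : ℂ × ℝ | f p.1 ≤ (p.2 : EReal)})
    (X P : Mat n) (lam g0 g1 : ℂ) (k : ℕ) (v l : Fin n → ℂ)
    (hact : f lam = specMax f X) (hg : HasRGrad f g0 lam) (hg0 : g0 ≠ 0)
    (hk : 1 ≤ k) (hPP : P * P = P)
    (hAP : (X - lam • (1 : Mat n)) * P = P * (X - lam • (1 : Mat n)))
    (hAk : (X - lam • (1 : Mat n)) ^ k * P = 0) (htr : P.trace = (k : ℂ))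
    (hAv : (X - lam • (1 : Mat n)) *ᵥ v = 0) (hlP : l ⬝ᵥ (P *ᵥ v) = 1)
    (t : ℝ) (ht : 0 < t) (hg1 : HasRGrad f g1 (lam + (t : ℂ) * g0)) :
    specMax f (X + ((t : ℂ) * g0) • P) = f (lam + (t : ℂ) * g0) ∧
    RegSubgrad (specMax f) (X + ((t : ℂ) * g0) • P) ((g1 / k) • Pᴴ) := by
  obtain ⟨s, hs⟩ : ∃ s : ℂ, s = (t : ℂ) * g0 := ⟨_, rfl⟩
  have hci := conv_ineq f hfbot hfconv g0 lam hg (lam + s)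
  rw [add_sub_cancel_left, hs, rIP_self_mul, ← hs] at hci
  rw [← hs] at hg1 ⊢
  have hlfin := hg.1.self_of_nhds
  have hgt : f lam < f (lam + s) := by
    refine lt_of_lt_of_le ?_ hci
    conv_lhs => rw [← EReal.coe_toReal hlfin.1 hlfin.2]
    rw [EReal.coe_lt_coe_iff]
    have : 0 < ‖g0‖ := norm_pos_iff.2 hg0
    have : 0 < t * ‖g0‖ ^ 2 := by positivity
    linarith
  have hleX : ∀ μ, IsEigenvalue X μ → f μ ≤ f lam := by
    intro μ hμ
    rw [hact]
    exact le_sSup ⟨μ, hμ, rfl⟩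
  have hXP : X * P = P * X := by
    simpa [sub_mul, mul_sub] using hAP
  set Z0 := X + s • P with hZ0
  have hZP : Z0 * P = P * Z0 := by
    rw [hZ0, add_mul, mul_add, hXP, Matrix.smul_mul, Matrix.mul_smul]
  have hM : (Z0 - (lam + s) • (1 : Mat n)) ^ k * P = 0 := by
    rw [pow_mul_congr _ (X - lam • (1 : Mat n)) P _ hAP, hAk]
    rw [hZ0, sub_mul, add_mul, Matrix.smul_mul, hPP, add_smul, add_mul, sub_mul]
    simp only [Matrix.smul_mul, Matrix.one_mul]
    abel
  have hb : aeval Z0 X.charpoly * (1 - P) = 0 := by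
    rw [aeval_mul_congr Z0 X (1 - P) _ _, Matrix.aeval_self_charpoly, zero_mul]
    · rw [hZ0, add_mul, Matrix.smul_mul, mul_sub P, mul_one P, hPP, sub_self, smul_zero, add_zero]
    · rw [mul_sub, sub_mul, hXP, mul_one, one_mul]
  have hnotX : ¬ IsEigenvalue X (lam + s) := fun h => absurd (hleX _ h) (not_le.2 hgt)
  have hbl : X.charpoly.eval (lam + s) ≠ 0 := by
    intro h0
    exact hnotX ((isEig_iff_root _ _).2 ((mem_roots X.charpoly_monic.ne_zero).2 h0))
  have hZeig : ∀ μ, IsEigenvalue Z0 μ → μ = lam + s ∨ IsEigenvalue X μ := by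
    intro μ hμ
    have h0 : aeval Z0 ((Polynomial.X - C (lam + s)) ^ k * X.charpoly) = 0 := by
      have hA : aeval Z0 (Polynomial.X - C (lam + s)) = Z0 - (lam + s) • (1 : Mat n) := by
        rw [map_sub, aeval_X, aeval_C, Algebra.algebraMap_eq_smul_one]
      have e1 : aeval Z0 ((Polynomial.X - C (lam + s)) ^ k * X.charpoly) * P = 0 := by
        rw [mul_comm, map_mul, map_pow, hA, mul_assoc, hM, mul_zero]
      have e2 : aeval Z0 ((Polynomial.X - C (lam + s)) ^ k * X.charpoly) * (1 - P) = 0 := by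
        rw [map_mul, mul_assoc, hb, mul_zero]
      rw [mul_sub, mul_one, e1, sub_zero] at e2
      exact e2
    have h1 := eig_root_of_aeval Z0 μ hμ _ h0
    rw [eval_mul, mul_eq_zero] at h1
    rcases h1 with h1 | h1
    · left
      rw [eval_pow] at h1
      have h2 := eq_zero_of_pow_eq_zero h1
      simpa [sub_eq_zero] using h2
    · right
      exact (isEig_iff_root _ _).2 ((mem_roots X.charpoly_monic.ne_zero).2 h1)
  have hZlam : IsEigenvalue Z0 (lam + s) := by
    rw [isEig_iff_vec]
    refine ⟨P *ᵥ v, ?_, ?_⟩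
    · intro h
      rw [h, dotProduct_zero] at hlP
      exact zero_ne_one hlP
    · have hXv : X *ᵥ v = lam • v := by
        rw [Matrix.sub_mulVec, Matrix.smul_mulVec, Matrix.one_mulVec, sub_eq_zero] at hAv
        exact hAv
      rw [hZ0, Matrix.add_mulVec, Matrix.smul_mulVec, Matrix.mulVec_mulVec, Matrix.mulVec_mulVec,
        hPP, hXP, ← Matrix.mulVec_mulVec, hXv, Matrix.mulVec_smul, add_smul]
  have hspec : specMax f Z0 = f (lam + s) := by
    apply le_antisymm
    · apply sSup_le
      rintro _ ⟨μ, hμ, rfl⟩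
      rcases hZeig μ hμ with h | h
      · rw [h]
      · exact (hleX μ h).trans hgt.le
    · exact le_sSup ⟨_, hZlam, rfl⟩
  have h1fin := hg1.1.self_of_nhds
  refine ⟨hspec, ?_, ?_, ?_⟩
  · rw [hspec]; exact h1fin.1
  · rw [hspec]; exact h1fin.2
  intro ε hε
  obtain ⟨δ, hδ, hkey⟩ := key_eig Z0 P (lam + s) k X.charpoly hk hZP hM hb hbl htr g1 ε hε
  refine ⟨δ, hδ, ?_⟩
  intro Z hZ
  by_cases hH : Z - Z0 = 0
  · have hZZ : Z = Z0 := sub_eq_zero.1 hH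
    have e1 : mip ((g1 / k) • Pᴴ) (Z - Z0) = 0 := by rw [hH]; simp [mip]
    have e2 : mnorm (Z - Z0) = 0 := by rw [hH]; simp [mnorm, mip]
    rw [e1, e2, hZZ, add_zero, mul_zero, sub_zero, hspec, EReal.coe_toReal h1fin.1 h1fin.2]
  · rw [mnorm_eq] at hZ
    obtain ⟨μ, hμ, hle⟩ := hkey _ hZ hH
    rw [add_sub_cancel] at hμ
    have h2 := conv_ineq f hfbot hfconv g1 (lam + s) hg1 μ
    refine le_trans ?_ (h2.trans (le_sSup ⟨μ, hμ, rfl⟩))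
    rw [hspec, EReal.coe_le_coe_iff, mip_smul_conj, mnorm_eq]
    have e1 : star (g1 / (k : ℂ)) * (P * (Z - Z0)).trace
        = star g1 * (P * (Z - Z0)).trace / k := by
      simp only [star_div₀, star_natCast]; ring
    have e2 : rIP g1 (μ - (lam + s)) = (star g1 * (μ - (lam + s))).re := rfl
    rw [e1, e2]
    linarith

lemma not_reg {n : ℕ} (f : ℂ → EReal)
    (X P : Mat n) (lam g0 : ℂ) (k : ℕ) (v l : Fin n → ℂ) (hg0 : g0 ≠ 0)
    (hk : 1 ≤ k) (hv0 : v ≠ 0)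
    (hAv : (X - lam • (1 : Mat n)) *ᵥ v = 0) (hlv : l ⬝ᵥ v = 0) (hlP : l ⬝ᵥ (P *ᵥ v) = 1) :
    ¬ RegSubgrad (specMax f) X ((g0 / k) • Pᴴ) := by
  rintro ⟨hfin1, hfin2, hreg⟩
  have hXv : X *ᵥ v = lam • v := by
    rw [Matrix.sub_mulVec, Matrix.smul_mulVec, Matrix.one_mulVec, sub_eq_zero] at hAv
    exact hAv
  set E : Mat n := Matrix.vecMulVec v l with hE
  have hle : ∀ s : ℂ, specMax f (X + s • E) ≤ specMax f X := by
    intro s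
    apply sSup_le
    rintro _ ⟨μ, hμ, rfl⟩
    exact le_sSup ⟨μ, eig_update X lam v l hXv hv0 hlv s μ hμ, rfl⟩
  have hn0 : 0 ≤ mnorm (g0 • E) := Real.sqrt_nonneg _
  have hk0 : (0 : ℝ) < k := by exact_mod_cast hk
  set κ : ℝ := ‖g0‖ ^ 2 / k with hκ
  have hκ0 : 0 < κ := by
    have : 0 < ‖g0‖ := norm_pos_iff.2 hg0
    positivity
  have hmip : ∀ t : ℝ, mip ((g0 / k) • Pᴴ) (((t : ℂ) * g0) • E) = t * κ := by
    intro t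
    have htr : (P * E).trace = 1 := by
      rw [hE, Matrix.mul_vecMulVec, Matrix.trace_vecMulVec, dotProduct_comm, hlP]
    rw [mip_smul_conj, Matrix.mul_smul, Matrix.trace_smul, htr, smul_eq_mul, mul_one]
    have : star (g0 / (k : ℂ)) * ((t : ℂ) * g0) = ((t / k : ℝ) : ℂ) * (g0 * (starRingEnd ℂ) g0) := by
      have h2 : star (g0 / (k : ℂ)) = (starRingEnd ℂ) g0 / k := by
        rw [star_div₀, star_natCast]; rfl
      rw [h2]; push_cast; ring
    rw [this, Complex.mul_conj, Complex.re_ofReal_mul, Complex.ofReal_re,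
      Complex.normSq_eq_norm_sq, hκ]
    ring
  have hmn : ∀ t : ℝ, 0 < t → mnorm (((t : ℂ) * g0) • E) = t * mnorm (g0 • E) := by
    intro t ht
    have e : mip (((t : ℂ) * g0) • E) (((t : ℂ) * g0) • E) = t ^ 2 * mip (g0 • E) (g0 • E) := by
      rw [mul_smul]
      generalize g0 • E = F
      simp only [mip, Matrix.conjTranspose_smul, Matrix.smul_mul, Matrix.mul_smul,
        Matrix.trace_smul, smul_eq_mul]
      rw [← starRingEnd_apply, Complex.conj_ofReal, Complex.re_ofReal_mul, Complex.re_ofReal_mul]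
      ring
    rw [mnorm, e, Real.sqrt_mul (by positivity), Real.sqrt_sq ht.le, ← mnorm]
  obtain ⟨δ, hδ, h⟩ := hreg (κ / (2 * (mnorm (g0 • E) + 1))) (by positivity)
  set N := mnorm (g0 • E) with hN
  set t : ℝ := δ / (2 * (N + 1)) with ht
  have ht0 : 0 < t := by positivity
  have h1 := h (X + ((t : ℂ) * g0) • E) (by
    rw [add_sub_cancel_left, hmn t ht0, ht, div_mul_eq_mul_div, div_lt_iff₀ (by positivity)]
    nlinarith)
  rw [add_sub_cancel_left, hmn t ht0, hmip] at h1
  have h2 := h1.trans (hle _)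
  conv_rhs at h2 => rw [← EReal.coe_toReal hfin1 hfin2]
  rw [EReal.coe_le_coe_iff] at h2
  have h4 : κ / (2 * (N + 1)) * N < κ := by
    rw [div_mul_eq_mul_div, div_lt_iff₀ (by positivity)]
    nlinarith
  nlinarith

end PartE

/-- If `f` is real-differentiable near every active eigenvalue with
gradient continuous there and nonvanishing, and some active eigenvalue of `X` has
geometric multiplicity at least 2, then the limiting subdifferential of the spectral
max function strictly contains the regular subdifferential at `X`. -/
theorem stmt4 {n : ℕ} (hn : 1 ≤ n) (f : ℂ → EReal)
    (hfbot : ∀ z, f z ≠ ⊥) (hfproper : ∃ z, f z ≠ ⊤)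
    (hflsc : LowerSemicontinuous f)
    (hfconv : Convex ℝ {p : ℂ × ℝ | f p.1 ≤ (p.2 : EReal)})
    (X : Mat n) (g : ℂ → ℂ)
    (hdiff : ∀ lam : ℂ, IsEigenvalue X lam → f lam = specMax f X →
      (∀ᶠ z in nhds lam, HasRGrad f (g z) z) ∧ ContinuousAt g lam ∧ g lam ≠ 0)
    (hderog : ∃ lam : ℂ, IsEigenvalue X lam ∧ f lam = specMax f X ∧ 2 ≤ geomMult X lam) :
    {Y : Mat n | RegSubgrad (specMax f) X Y} ⊂ {Y : Mat n | LimSubgrad (specMax f) X Y} := by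
  obtain ⟨lam, hlam, hact, hgm⟩ := hderog
  obtain ⟨hev, hgc, hg0⟩ := hdiff lam hlam hact
  have hg : HasRGrad f (g lam) lam := hev.self_of_nhds
  obtain ⟨P, k, v, l, hk, hPP, hAP, hAk, htr, hv0, hAv, hlv, hlP⟩ :=
    exists_proj (X - lam • (1 : Mat n)) hgm
  have hlfin := hg.1.self_of_nhds
  rw [Set.ssubset_iff_of_subset]
  · refine ⟨(g lam / k) • Pᴴ, ?_, not_reg f X P lam (g lam) k v l hg0 hk hv0 hAv hlv hlP⟩
    obtain ⟨ρ, hρ, hball⟩ := Metric.eventually_nhds_iff.1 hev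
    have hgn : 0 < ‖g lam‖ := norm_pos_iff.2 hg0
    -- the step sizes
    obtain ⟨t, ht0, htlt, htlim⟩ : ∃ t : ℕ → ℝ, (∀ ν, 0 < t ν) ∧ (∀ ν, t ν * ‖g lam‖ < ρ) ∧
        Tendsto t atTop (nhds 0) := by
      refine ⟨fun ν => (ρ / (2 * ‖g lam‖)) * (1 / ((ν : ℝ) + 1)), fun ν => by positivity, ?_, ?_⟩
      · intro ν
        have h1 : (1 : ℝ) / ((ν : ℝ) + 1) ≤ 1 := by
          rw [div_le_one (by positivity)]
          linarith [(Nat.cast_nonneg ν : (0 : ℝ) ≤ ν)]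
        calc ρ / (2 * ‖g lam‖) * (1 / ((ν : ℝ) + 1)) * ‖g lam‖
            = ρ / 2 * (1 / ((ν : ℝ) + 1)) := by field_simp
          _ ≤ ρ / 2 * 1 := by gcongr
          _ < ρ := by linarith
      · have := (tendsto_one_div_add_atTop_nhds_zero_nat (𝕜 := ℝ)).const_mul (ρ / (2 * ‖g lam‖))
        simpa using this
    have hs : Tendsto (fun ν => (t ν : ℂ) * g lam) atTop (nhds 0) := by
      have h1 : Tendsto (fun ν => (t ν : ℂ)) atTop (nhds ((0 : ℝ) : ℂ)) :=
        (Complex.continuous_ofReal.tendsto 0).comp htlim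
      have := h1.mul_const (g lam)
      simpa using this
    have hz : Tendsto (fun ν => lam + (t ν : ℂ) * g lam) atTop (nhds lam) := by
      simpa using hs.const_add lam
    have hstep := fun ν => reg_step f hfbot hfconv X P lam (g lam)
      (g (lam + (t ν : ℂ) * g lam)) k v l hact hg hg0 hk hPP hAP hAk htr hAv hlP (t ν) (ht0 ν)
      (hball (by
        rw [dist_eq_norm, add_sub_cancel_left, norm_mul, Complex.norm_real, Real.norm_eq_abs,
          abs_of_pos (ht0 ν)]
        exact htlt ν))
    refine ⟨fun ν => X + ((t ν : ℂ) * g lam) • P,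
      fun ν => (g (lam + (t ν : ℂ) * g lam) / k) • Pᴴ, ?_, ?_, fun ν => (hstep ν).2, ?_⟩
    · have := (hs.smul_const P).const_add X
      simpa using this
    · have e : (fun ν => specMax f (X + ((t ν : ℂ) * g lam) • P))
          = fun ν => f (lam + (t ν : ℂ) * g lam) := funext fun ν => (hstep ν).1
      rw [e, ← hact]
      have hreal : Tendsto (fun δ : ℂ => (f (lam + δ)).toReal) (nhds 0)
          (nhds (f lam).toReal) := by
        have h1 : Tendsto (fun δ : ℂ => (f (lam + δ)).toReal - (f lam).toReal - rIP (g lam) δ)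
            (nhds 0) (nhds 0) := by
          refine hg.2.trans_tendsto ?_
          have := (continuous_norm (E := ℂ)).tendsto 0
          simpa using this
        have h2 : Tendsto (fun δ : ℂ => rIP (g lam) δ) (nhds 0) (nhds 0) := by
          have hc : Continuous (fun δ : ℂ => rIP (g lam) δ) := by
            unfold rIP; fun_prop
          have := hc.tendsto 0
          simpa [rIP] using this
        have h3 := (h1.add h2).add_const (f lam).toReal
        simpa using h3
      have h4 := (continuous_coe_real_ereal.tendsto _).comp (hreal.comp hs)
      rw [EReal.coe_toReal hlfin.1 hlfin.2] at h4
      refine h4.congr' ?_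
      filter_upwards [hz.eventually hg.1] with ν hν
      exact EReal.coe_toReal hν.1 hν.2
    · have h1 : Tendsto (fun ν => g (lam + (t ν : ℂ) * g lam)) atTop (nhds (g lam)) :=
        Tendsto.comp hgc hz
      exact (h1.div_const (k : ℂ)).smul_const Pᴴ
  · intro Y hY
    exact ⟨fun _ => X, fun _ => Y, tendsto_const_nhds, tendsto_const_nhds, fun _ => hY,
      tendsto_const_nhds⟩
end
end

section
/- Let n ≥ 1 and ξ ∈ ℂ be fixed, and define h : ℂⁿ → ℂ by h(λ₀, …, λ_{n−1}) := det(ξ·I − N_n − Σ_{s=0}^{n−1} λ_s·(N_nᵀ)^s), where N_nᵀ is the transpose of N_n and (N_nᵀ)⁰ := I. Then h(0) = ξⁿ, and h is differentiable at 0 with ℂ-linear derivative δ ↦ −Σ_{s=0}^{n−1} (n − s)·δ_s·ξ^{n−s−1}; equivalently, h(λ) − ξⁿ + Σ_{s=0}^{n−1} (n − s)·λ_s·ξ^{n−s−1} = o(‖λ‖) as λ → 0 in ℂⁿ. -/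
open Matrix Filter Topology Asymptotics

noncomputable section

/-- `Nmat k` is the `k × k` matrix with ones on the superdiagonal and zeros elsewhere. -/
def Nmat (k : ℕ) : Matrix (Fin k) (Fin k) ℂ :=
  fun a b => if (b : ℕ) = (a : ℕ) + 1 then 1 else 0

/-- `hdet n ξ λ = det (ξ I − N_n − Σ_{s=0}^{n−1} λ_s (N_nᵀ)^s)`. -/
def hdet (n : ℕ) (ξ : ℂ) (lam : Fin n → ℂ) : ℂ :=
  (ξ • (1 : Matrix (Fin n) (Fin n) ℂ) - Nmat n -
    ∑ s : Fin n, lam s • ((Nmat n)ᵀ ^ (s : ℕ))).det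

theorem Nmat_pow_apply (n k : ℕ) (a b : Fin n) :
    (Nmat n ^ k) a b = if (b : ℕ) = (a : ℕ) + k then 1 else 0 := by
  induction k generalizing a b with
  | zero => simp [Matrix.one_apply, Fin.ext_iff, eq_comm]
  | succ k ih =>
    rw [pow_succ, Matrix.mul_apply]
    simp_rw [ih]
    by_cases h : (a : ℕ) + k < n
    · rw [Finset.sum_eq_single (⟨a + k, h⟩ : Fin n)]
      · simp [Nmat, add_assoc]
      · intro c _ hc
        have : (c : ℕ) ≠ a + k := fun h' => hc (Fin.ext h')
        simp [this]
      · simp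
    · have hb := b.2
      rw [if_neg (by omega)]
      apply Finset.sum_eq_zero
      intro c _
      have hc := c.2
      rw [if_neg (by omega), zero_mul]

theorem trace_pow_pow (n k s : ℕ) (hs : s ≤ n) :
    ((Nmat n ^ k) * ((Nmat n)ᵀ ^ s)).trace = if k = s then (n : ℂ) - s else 0 := by
  have h1 : ∀ a : Fin n, ((Nmat n ^ k) * ((Nmat n)ᵀ ^ s)) a a =
      if k = s ∧ (a : ℕ) < n - s then 1 else 0 := by
    intro a
    rw [← Matrix.transpose_pow, Matrix.mul_apply]
    simp_rw [Matrix.transpose_apply, Nmat_pow_apply]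
    split_ifs with h
    · obtain ⟨rfl, h⟩ := h
      rw [Finset.sum_eq_single (⟨a + k, by omega⟩ : Fin n)]
      · simp
      · intro c _ hc
        have : (c : ℕ) ≠ a + k := fun h' => hc (Fin.ext h')
        simp [this]
      · simp
    · apply Finset.sum_eq_zero
      intro c _
      have hc := c.2
      by_cases h2 : (c : ℕ) = a + k
      · rw [if_neg (c := (c : ℕ) = a + s) (by omega), mul_zero]
      · rw [if_neg h2, zero_mul]
  simp only [Matrix.trace, Matrix.diag_apply, h1]
  by_cases h : k = s
  · simp only [h, true_and, if_true]
    rw [Fin.sum_univ_eq_sum_range (fun a => if a < n - s then (1 : ℂ) else 0) n,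
      ← Finset.sum_filter]
    have : (Finset.range n).filter (fun a => a < n - s) = Finset.range (n - s) := by
      ext x; simp; omega
    rw [this]
    simp [Nat.cast_sub hs]
  · simp [h]

theorem det_base (n : ℕ) (ξ : ℂ) :
    (ξ • (1 : Matrix (Fin n) (Fin n) ℂ) - Nmat n).det = ξ ^ n := by
  rw [Matrix.det_of_upperTriangular]
  · simp [Nmat]
  · intro i j hij
    have hij' : (j : ℕ) < i := hij
    have h1 : i ≠ j := by rintro rfl; omega
    have h2 : (j : ℕ) ≠ i + 1 := by omega
    simp [Nmat, h1, h2]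

theorem adj_base (n : ℕ) (ξ : ℂ) :
    (ξ • (1 : Matrix (Fin n) (Fin n) ℂ) - Nmat n).adjugate =
      ∑ k ∈ Finset.range n, ξ ^ (n - 1 - k) • Nmat n ^ k := by
  have hne : ∀ z : ℂ, z ≠ 0 →
      (z • (1 : Matrix (Fin n) (Fin n) ℂ) - Nmat n).adjugate =
      ∑ k ∈ Finset.range n, z ^ (n - 1 - k) • Nmat n ^ k := by
    intro z hz
    set A := z • (1 : Matrix (Fin n) (Fin n) ℂ) - Nmat n with hA
    have hN : Nmat n ^ n = 0 := by
      ext a b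
      have := b.2
      rw [Nmat_pow_apply, if_neg (by omega)]; rfl
    have hc : Commute (z • (1 : Matrix (Fin n) (Fin n) ℂ)) (Nmat n) :=
      (Commute.one_left _).smul_left z
    have h1 : A * ∑ k ∈ Finset.range n, z ^ (n - 1 - k) • Nmat n ^ k =
        z ^ n • (1 : Matrix (Fin n) (Fin n) ℂ) := by
      have := hc.symm.mul_geom_sum₂ n
      rw [hN, zero_sub, smul_pow, one_pow] at this
      rw [← neg_inj, ← this, ← neg_mul, hA, neg_sub]
      congr 1
      apply Finset.sum_congr rfl
      intro k _
      simp [smul_pow]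
    have h2 : A.adjugate * A = z ^ n • (1 : Matrix (Fin n) (Fin n) ℂ) := by
      rw [Matrix.adjugate_mul, det_base]
    have h3 := congrArg (A.adjugate * ·) h1
    simp only [← mul_assoc, h2] at h3
    simp only [smul_mul_assoc, one_mul, mul_smul_comm, mul_one] at h3
    exact (smul_right_injective _ (pow_ne_zero n hz) h3).symm
  have hcont1 : Continuous fun z : ℂ =>
      (z • (1 : Matrix (Fin n) (Fin n) ℂ) - Nmat n).adjugate := by
    apply Continuous.matrix_adjugate
    fun_prop
  have hcont2 : Continuous fun z : ℂ =>
      ∑ k ∈ Finset.range n, z ^ (n - 1 - k) • Nmat n ^ k := by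
    fun_prop
  have := Continuous.ext_on (dense_compl_singleton (0 : ℂ)) hcont1 hcont2
    (fun z hz => hne z hz)
  exact congrFun this ξ

theorem sum_det_update (n : ℕ) (A B : Matrix (Fin n) (Fin n) ℂ) :
    ∑ i, (A.updateRow i (B i)).det = (A.adjugate * B).trace := by
  rw [Matrix.trace_mul_comm, Matrix.trace]
  apply Finset.sum_congr rfl
  intro i _
  rw [Matrix.det_eq_sum_mul_adjugate_row _ i, Matrix.diag_apply, Matrix.mul_apply]
  apply Finset.sum_congr rfl
  intro j _
  simp [Matrix.adjugate_apply]

def detCM (n : ℕ) : ContinuousMultilinearMap ℂ (fun _ : Fin n => Fin n → ℂ) ℂ :=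
  { (Matrix.detRowAlternating : (Fin n → ℂ) [⋀^Fin n]→ₗ[ℂ] ℂ).toMultilinearMap with
    cont := Continuous.matrix_det (A := fun M : Matrix (Fin n) (Fin n) ℂ => M) continuous_id }

theorem detCM_apply (n : ℕ) (M : Matrix (Fin n) (Fin n) ℂ) : detCM n M = M.det := rfl

def pertL (n : ℕ) : (Fin n → ℂ) →ₗ[ℂ] (Fin n → Fin n → ℂ) where
  toFun lam := (∑ s : Fin n, lam s • ((Nmat n)ᵀ ^ (s : ℕ)) : Matrix (Fin n) (Fin n) ℂ)
  map_add' x y := by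
    simp only [Pi.add_apply, add_smul, Finset.sum_add_distrib]; rfl
  map_smul' c x := by
    simp only [Pi.smul_apply, smul_assoc, ← Finset.smul_sum]; rfl

/-- `h(0) = ξⁿ` and `h` is differentiable at `0` with ℂ-linear
derivative `δ ↦ −Σ_s (n−s) δ_s ξ^{n−s−1}`, expressed as a little-o estimate. -/
theorem stmt6 (n : ℕ) (hn : 1 ≤ n) (ξ : ℂ) :
    hdet n ξ 0 = ξ ^ n ∧
    (fun lam : Fin n → ℂ =>
        hdet n ξ lam - ξ ^ n +
          ∑ s : Fin n, ((n : ℂ) - (s : ℕ)) * lam s * ξ ^ (n - (s : ℕ) - 1))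
      =o[nhds (0 : Fin n → ℂ)] (fun lam => ‖lam‖) := by
  have h0 : hdet n ξ 0 = ξ ^ n := by simp [hdet, det_base]
  refine ⟨h0, ?_⟩
  set A : Matrix (Fin n) (Fin n) ℂ := ξ • (1 : Matrix (Fin n) (Fin n) ℂ) - Nmat n with hA
  let L : (Fin n → ℂ) →L[ℂ] (Fin n → Fin n → ℂ) := LinearMap.toContinuousLinearMap (pertL n)
  let A' : Fin n → Fin n → ℂ := A
  have hL : HasFDerivAt (fun lam => A' - L lam) (-L) 0 := (L.hasFDerivAt).const_sub A'
  have hD := ((detCM n).hasFDerivAt (A' - L 0)).comp (0 : Fin n → ℂ) hL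
  have hf : (detCM n) ∘ (fun lam => A' - L lam) = hdet n ξ := rfl
  rw [hf] at hD
  have key : ∀ lam : Fin n → ℂ, ((detCM n).linearDeriv (A' - L 0)) ((-L) lam) =
      - ∑ s : Fin n, ((n : ℂ) - (s : ℕ)) * lam s * ξ ^ (n - (s : ℕ) - 1) := by
    intro lam
    rw [map_zero, sub_zero, ContinuousLinearMap.neg_apply, map_neg,
      ContinuousMultilinearMap.linearDeriv_apply]
    have := sum_det_update n A (∑ s : Fin n, lam s • ((Nmat n)ᵀ ^ (s : ℕ)))
    refine congrArg Neg.neg (Eq.trans this ?_)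
    rw [hA, adj_base, Matrix.mul_sum, Matrix.trace_sum]
    apply Finset.sum_congr rfl
    intro s _
    rw [Matrix.sum_mul, Matrix.trace_sum]
    simp only [smul_mul_assoc, mul_smul_comm, Matrix.trace_smul, trace_pow_pow n _ s s.2.le]
    rw [Finset.sum_eq_single (s : ℕ)]
    · simp only [if_true, smul_eq_mul]
      rw [Nat.sub_right_comm]
      ring
    · intro k _ hk
      simp [hk]
    · intro h
      exact absurd (Finset.mem_range.2 s.2) h
  have hD2 := hD.isLittleO
  refine Asymptotics.IsLittleO.norm_right ?_
  refine hD2.congr (fun lam => ?_) (fun lam => ?_)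
  · rw [h0, sub_zero, ContinuousLinearMap.comp_apply, key, sub_neg_eq_add]
  · simp
end
end
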